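/- Let q be a prime power and let Θ(t) = t^{-1} Σ_{i=0}^∞ s_i t^{-i} ∈ F_q((t^{-1})) be a quadratic irrational with coefficient sequence S = (s_i)_{i≥0}. For each k ≥ 0 the k-th diagonal (W̃[m,k])_{m≥0} of the number wall of S is eventually periodic; let h_{k,0} < h_{k,1} < ... < h_{k,ℓ_k} be consecutive row indices of nonzero entries of this diagonal lying in its periodic part, chosen so that h_{k,ℓ_k} − h_{k,0} equals one full period. Then for c ∈ (0,1], Θ exhibits c escape of mass with respect to {t^k}_{k≥0} if and only if lim_{n→∞} liminf_{k→∞} (Σ_{i=1}^{ℓ_k} max{h_{k,i} − h_{k,i−1} − n, 0}) / (h_{k,ℓ_k} − h_{k,0}) ≥ c. -/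

import Mathlib

open scoped Classical
open Filter Polynomial

noncomputable section

namespace EscapeOfMass

variable {K : Type*} [Field K]

/-- The element `t` of `K((t⁻¹))`, modelled as the Laurent series field `K⸨X⸩`
in the variable `X = t⁻¹`; thus `t = X⁻¹ = single (-1) 1`. -/
def tLS (K : Type*) [Field K] : LaurentSeries K := HahnSeries.single (-1 : ℤ) 1

/-- The polynomial part of a Laurent series in `K((t⁻¹))` (the terms with
non-negative powers of `t`, i.e. non-positive powers of `X`). -/
def polyPart (f : LaurentSeries K) : LaurentSeries K :=
  { coeff := fun n => if n ≤ 0 then f.coeff n else 0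
    isPWO_support' := by
      refine f.isPWO_support'.mono fun n hn => ?_
      simp only [Function.mem_support, ne_eq] at hn ⊢
      intro h
      exact hn (by simp [h]) }

/-- The fractional part `⟨f⟩` of a Laurent series in `K((t⁻¹))`. -/
def fracPart (f : LaurentSeries K) : LaurentSeries K := f - polyPart f

/-- The complete quotients of the continued fraction expansion of `f`. -/
def cfQuot (f : LaurentSeries K) : ℕ → LaurentSeries K
  | 0 => f
  | i + 1 => (cfQuot f i - polyPart (cfQuot f i))⁻¹

/-- The partial quotients `A_i` of the continued fraction expansion of `f`. -/
def cfPQ (f : LaurentSeries K) (i : ℕ) : LaurentSeries K := polyPart (cfQuot f i)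

/-- The degree (as an integer) of a Laurent series viewed in `K((t⁻¹))`:
for a nonzero polynomial in `t` this is the usual degree. -/
def degZ (f : LaurentSeries K) : ℤ := -f.order

/-- `f` is a rational Laurent series, i.e. lies in `K(t)`. -/
def IsRatLS (f : LaurentSeries K) : Prop := ∃ r : RatFunc K, (r : LaurentSeries K) = f

/-- `f` is a quadratic irrational: it is irrational and a root of a quadratic
polynomial with coefficients in `K[t]`. -/
def IsQuadIrr (f : LaurentSeries K) : Prop :=
  ¬ IsRatLS f ∧ ∃ a b c : Polynomial K, a ≠ 0 ∧
    Polynomial.aeval (tLS K) a * f ^ 2 + Polynomial.aeval (tLS K) b * f +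
      Polynomial.aeval (tLS K) c = 0

/-- `(m, ℓ)` is a window for the periodic part of the continued fraction of `f`:
the partial quotients are periodic with period `ℓ ≥ 1` from index `m + 1` on. -/
def PeriodWindow (f : LaurentSeries K) (m ℓ : ℕ) : Prop :=
  1 ≤ ℓ ∧ ∀ i : ℕ, m + 1 ≤ i → cfPQ f (i + ℓ) = cfPQ f i

/-- The `n`-escape of mass of the continued fraction expansion of `f`: the proportion,
within one period of the periodic part of the partial quotients of `f`, of the sum
`∑ max (deg A_i - n) 0` relative to `∑ deg A_i`. -/
def eMassOf (f : LaurentSeries K) (n : ℕ) : ℝ :=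
  if h : ∃ s : ℕ × ℕ, PeriodWindow f s.1 s.2 then
    (∑ i ∈ Finset.Ico ((Classical.choose h).1 + 1)
        ((Classical.choose h).1 + 1 + (Classical.choose h).2),
        max ((degZ (cfPQ f i) : ℝ) - n) 0) /
    (∑ i ∈ Finset.Ico ((Classical.choose h).1 + 1)
        ((Classical.choose h).1 + 1 + (Classical.choose h).2),
        (degZ (cfPQ f i) : ℝ))
  else 0

/-- The `n`-escape of mass in the `k`-th diagonal of `f` with respect to the
sequence `{g^k}`. -/
def eMassP (g f : LaurentSeries K) (k n : ℕ) : ℝ := eMassOf (g ^ k * f) n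

/-- The `n`-escape of mass in the `k`-th diagonal of `f` with respect to `{t^k}`. -/
def eMass (f : LaurentSeries K) (k n : ℕ) : ℝ := eMassP (tLS K) f k n

/-- `f` exhibits `c` escape of mass with respect to the sequence `{g^k}`. -/
def ExhibitsEscape (g f : LaurentSeries K) (c : ℝ) : Prop :=
  ∃ L : ℝ, Tendsto (fun n : ℕ => Filter.liminf (fun k : ℕ => eMassP g f k n) atTop)
    atTop (nhds L) ∧ c ≤ L

/-- `f` exhibits exactly `c` escape of mass with respect to the sequence `{g^k}`. -/
def ExhibitsExactEscape (g f : LaurentSeries K) (c : ℝ) : Prop :=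
  Tendsto (fun n : ℕ => Filter.liminf (fun k : ℕ => eMassP g f k n) atTop)
    atTop (nhds c)

/-- `f` exhibits full (`c = 1`) maximal escape of mass with respect to `{g^k}`. -/
def ExhibitsFullMaxEscape (g f : LaurentSeries K) : Prop :=
  Tendsto (fun n : ℕ => Filter.limsup (fun k : ℕ => eMassP g f k n) atTop)
    atTop (nhds 1)

/-- `A ⊆ ℕ` has natural density `c`. -/
def HasDensity (A : Set ℕ) (c : ℝ) : Prop :=
  Tendsto (fun M : ℕ => (((Finset.Icc 1 M).filter fun k => k ∈ A).card : ℝ) / M)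
    atTop (nhds c)

/-- `f` exhibits full generic escape of mass with respect to `{t^k}`. -/
def FullGenericEscape (f : LaurentSeries K) : Prop :=
  ∀ ε : ℝ, 0 < ε → ∃ dens : ℕ → ℝ,
    (∀ n : ℕ, HasDensity {k : ℕ | 1 - ε < eMass f k n} (dens n)) ∧
    Tendsto dens atTop (nhds 1)

/-- Substitution `t ↦ P(t)` on Laurent series: for `f = ∑_{i ≥ d} a_i t^{-i}` (with
`d = f.order` in the variable `X = t⁻¹`), `substLS f P = ∑_{i ≥ d} a_i P(t)^{-i}`. -/
def substLS (f : LaurentSeries K) (P : Polynomial K) : LaurentSeries K :=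
  (Polynomial.aeval (tLS K) P)⁻¹ ^ f.order *
    HahnSeries.ofPowerSeries ℤ K
      (PowerSeries.mk fun n =>
        ∑ j ∈ Finset.range (n + 1),
          f.coeff (f.order + j) * (((Polynomial.aeval (tLS K) P)⁻¹ ^ j).coeff (n : ℤ)))

/-- The `p`-Cantor sequence over `ZMod p`. -/
def cantor (p : ℕ) : ℕ → ZMod p
  | 0 => 1
  | (n + 1) =>
    if hp : 1 < p then
      if (n + 1) % p % 2 = 1 then 0
      else (((p - 1) / 2).choose (((n + 1) % p) / 2) : ZMod p) * cantor p ((n + 1) / p)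
    else 0
  decreasing_by exact Nat.div_lt_self (Nat.succ_pos _) hp

/-- `Θ̃_p = ∑_{i ≥ 0} c_i^{(p)} t^{-i}`. -/
def cantorTilde (p : ℕ) : LaurentSeries (ZMod p) :=
  HahnSeries.ofPowerSeries ℤ (ZMod p) (PowerSeries.mk fun i => cantor p i)

/-- `Θ_p = t⁻¹ ∑_{i ≥ 0} c_i^{(p)} t^{-i}`. -/
def cantorTheta (p : ℕ) : LaurentSeries (ZMod p) :=
  HahnSeries.single (1 : ℤ) 1 * cantorTilde p

/-- The Thue–Morse sequence over `ZMod 2`. -/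
def thueMorse (n : ℕ) : ZMod 2 := ((Nat.digits 2 n).sum : ZMod 2)

/-- The Thue–Morse Laurent series `τ = ∑_{n ≥ 1} τ_n t^{-n}`. -/
def tmSeries : LaurentSeries (ZMod 2) :=
  HahnSeries.ofPowerSeries ℤ (ZMod 2) (PowerSeries.mk fun n => thueMorse n)

/-- The extension of a one-sided sequence to `ℤ` by zero. -/
def extendSeq (S : ℕ → K) : ℤ → K := fun i => if 0 ≤ i then S i.toNat else 0

/-- The entry `W(S)[m, n]` of the number wall of the (doubly infinite) sequence `s`:
the determinant of the `(m+1) × (m+1)` Toeplitz matrix `(s_{n - i + j})`. -/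
def wallEntry (s : ℤ → K) (m : ℕ) (n : ℤ) : K :=
  (Matrix.of fun i j : Fin (m + 1) => s (n - (i : ℕ) + (j : ℕ))).det

/-- The Laurent series `t⁻¹ ∑_{i ≥ 0} s_i t^{-i}` associated to a sequence. -/
def seriesOf (S : ℕ → K) : LaurentSeries K :=
  HahnSeries.single (1 : ℤ) 1 * HahnSeries.ofPowerSeries ℤ K (PowerSeries.mk S)

/-- The coefficient sequence of `Θ = t⁻¹ ∑ s_i t^{-i}`, extended to `ℤ` by zero. -/
def coeffSeq (f : LaurentSeries K) : ℤ → K := fun i => if 0 ≤ i then f.coeff (i + 1) else 0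

/-- The absolute value of a Laurent series in `F_q((t⁻¹))`: `|f| = q^{deg f}`. -/
def absLS {K : Type*} [Field K] [Fintype K] (f : LaurentSeries K) : ℝ :=
  if f = 0 then 0 else (Fintype.card K : ℝ) ^ (-f.order)



/-- Hankel determinants. -/
def hk (f : LaurentSeries K) (n : ℕ) : K :=
  (Matrix.of fun i j : Fin n => f.coeff (1 + ((i : ℕ) : ℤ) + ((j : ℕ) : ℤ))).det

lemma conv_coeff (f g : LaurentSeries K) (N : ℤ) (s : Finset ℤ)
    (hs : ∀ u, f.coeff u ≠ 0 → g.coeff (N - u) ≠ 0 → u ∈ s) :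
    (f * g).coeff N = ∑ u ∈ s, f.coeff u * g.coeff (N - u) := by
  rw [HahnSeries.coeff_mul]
  refine Finset.sum_bij_ne_zero (fun a _ _ => a.1) ?_ ?_ ?_ ?_
  · rintro ⟨a, b⟩ h _
    simp only [Finset.mem_addAntidiagonal, HahnSeries.mem_support] at h
    obtain ⟨h1, h2, h3⟩ := h
    refine hs a h1 ?_
    rwa [show N - a = b by omega]
  · rintro ⟨a, b⟩ h _ ⟨c, d⟩ h' _ e
    simp only [Finset.mem_addAntidiagonal, HahnSeries.mem_support] at h h'
    simp only at e
    ext <;> simp <;> omega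
  · intro b hb hne
    refine ⟨(b, N - b), ?_, hne, rfl⟩
    simp only [Finset.mem_addAntidiagonal, HahnSeries.mem_support]
    exact ⟨left_ne_zero_of_mul hne, right_ne_zero_of_mul hne, by omega⟩
  · rintro ⟨a, b⟩ h _
    simp only [Finset.mem_addAntidiagonal, HahnSeries.mem_support] at h
    simp only
    rw [show N - a = b by omega]

lemma key_sum (f β : LaurentSeries K) (d n i j : ℕ) (hfβ : f * β = 1)
    (hf : ∀ u : ℤ, u < d → f.coeff u = 0) (hβ : ∀ u : ℤ, u < -d → β.coeff u = 0)
    (hi : i < d + n) (hj : j < n) :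
    (∑ l ∈ Finset.range (d + n), f.coeff (1 + (i : ℤ) + l) * β.coeff ((j : ℤ) - l)) +
      ∑ l ∈ Finset.range n, f.coeff ((i : ℤ) - l) * β.coeff (1 + (l : ℤ) + j) = 0 := by
  have h := conv_coeff f β (1 + i + j)
    (((Finset.range (d + n)).image fun l : ℕ => (1 + (i : ℤ) + l)) ∪
      ((Finset.range n).image fun l : ℕ => ((i : ℤ) - l))) (by
      intro u hu hv
      have h1 : (d : ℤ) ≤ u := by
        by_contra hc
        exact hu (hf u (by omega))
      have h2 : (-d : ℤ) ≤ 1 + i + j - u := by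
        by_contra hc
        exact hv (hβ _ (by omega))
      simp only [Finset.mem_union, Finset.mem_image, Finset.mem_range]
      by_cases hui : 1 + (i : ℤ) ≤ u
      · left
        exact ⟨(u - 1 - i).toNat, by omega, by omega⟩
      · right
        exact ⟨(i - u).toNat, by omega, by omega⟩)
  rw [hfβ, Finset.sum_union, Finset.sum_image, Finset.sum_image, HahnSeries.coeff_one,
    if_neg (by omega)] at h
  · rw [h]
    congr 1
    · refine Finset.sum_congr rfl fun l _ => ?_
      congr 2; ring
    · refine Finset.sum_congr rfl fun l _ => ?_
      congr 2; ring
  · intro a _ b _ e; simp only at e; omega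
  · intro a _ b _ e; simp only at e; omega
  · rw [Finset.disjoint_left]
    intro a ha hb
    simp only [Finset.mem_image, Finset.mem_range] at ha hb
    obtain ⟨l, _, rfl⟩ := ha
    obtain ⟨l', _, h'⟩ := hb
    omega

lemma hk_step (f β : LaurentSeries K) (d n : ℕ) (hfβ : f * β = 1)
    (hf : ∀ u : ℤ, u < d → f.coeff u = 0) (hβ : ∀ u : ℤ, u < -d → β.coeff u = 0) :
    hk f (d + n) * (β.coeff (-d)) ^ n = hk f d * ((-1) ^ n * ((f.coeff d) ^ n * hk β n)) := by
  set H11 : Matrix (Fin d) (Fin d) K :=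
    Matrix.of fun i j => f.coeff (1 + ((i : ℕ) : ℤ) + ((j : ℕ) : ℤ)) with hH11
  set H12 : Matrix (Fin d) (Fin n) K :=
    Matrix.of fun i j => f.coeff (1 + ((i : ℕ) : ℤ) + ((d + (j : ℕ) : ℕ) : ℤ)) with hH12
  set H21 : Matrix (Fin n) (Fin d) K :=
    Matrix.of fun i j => f.coeff (1 + ((d + (i : ℕ) : ℕ) : ℤ) + ((j : ℕ) : ℤ)) with hH21
  set H22 : Matrix (Fin n) (Fin n) K :=
    Matrix.of fun i j => f.coeff (1 + ((d + (i : ℕ) : ℕ) : ℤ) + ((d + (j : ℕ) : ℕ) : ℤ)) with hH22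
  set B : Matrix (Fin d) (Fin n) K :=
    Matrix.of fun i j => β.coeff (((j : ℕ) : ℤ) - ((i : ℕ) : ℤ)) with hB
  set C : Matrix (Fin n) (Fin n) K :=
    Matrix.of fun i j => β.coeff (((j : ℕ) : ℤ) - ((d + (i : ℕ) : ℕ) : ℤ)) with hC
  set L : Matrix (Fin n) (Fin n) K :=
    Matrix.of fun i j => f.coeff (((d + (i : ℕ) : ℕ) : ℤ) - ((j : ℕ) : ℤ)) with hL
  set G : Matrix (Fin n) (Fin n) K :=
    Matrix.of fun i j => β.coeff (1 + ((i : ℕ) : ℤ) + ((j : ℕ) : ℤ)) with hG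
  have e1 : hk f (d + n) = (Matrix.fromBlocks H11 H12 H21 H22).det := by
    unfold hk
    rw [← Matrix.det_submatrix_equiv_self finSumFinEquiv]
    congr 1
    ext x y
    rcases x with x | x <;> rcases y with y | y <;> simp [hH11, hH12, hH21, hH22]
  have z1 : H11 * B + H12 * C = 0 := by
    ext i j
    have h := key_sum f β d n i j hfβ hf hβ (by omega) j.2
    rw [Finset.sum_range_add, Finset.sum_range, Finset.sum_range] at h
    rw [Finset.sum_eq_zero (s := Finset.range n), add_zero] at h
    · simpa [Matrix.mul_apply, hH11, hH12, hB, hC] using h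
    · intro l _
      rw [hf _ (by omega), zero_mul]
  have z2 : H21 * B + H22 * C = -(L * G) := by
    ext i j
    have h := key_sum f β d n (d + i) j hfβ hf hβ (by omega) j.2
    rw [Finset.sum_range_add, Finset.sum_range, Finset.sum_range, Finset.sum_range] at h
    rw [add_eq_zero_iff_eq_neg] at h
    simpa [Matrix.mul_apply, hH21, hH22, hB, hC, hL, hG] using h
  have e2 : Matrix.fromBlocks H11 H12 H21 H22 * Matrix.fromBlocks 1 B 0 C =
      Matrix.fromBlocks H11 0 H21 (-(L * G)) := by
    rw [Matrix.fromBlocks_multiply, z1, z2]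
    simp
  have dC : C.det = (β.coeff (-d)) ^ n := by
    rw [Matrix.det_of_upperTriangular]
    · simp [hC]
    · intro i j hij
      simp only [id] at hij
      simp only [hC, Matrix.of_apply]
      exact hβ _ (by have : (j : ℕ) < i := hij
                     omega)
  have dL : L.det = (f.coeff d) ^ n := by
    rw [Matrix.det_of_lowerTriangular]
    · simp [hL]
    · intro i j hij
      have hij' : (i : ℕ) < j := hij
      simp only [hL, Matrix.of_apply]
      exact hf _ (by omega)
  have e3 := congrArg Matrix.det e2
  rw [Matrix.det_mul, Matrix.det_fromBlocks_zero₂₁, Matrix.det_fromBlocks_zero₁₂, ← e1,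
    Matrix.det_one, one_mul, dC, Matrix.det_neg, Matrix.det_mul, dL, Fintype.card_fin] at e3
  exact e3

lemma hk_zero (f : LaurentSeries K) : hk f 0 = 1 := by
  simp [hk]

lemma hk_small (f : LaurentSeries K) (d n : ℕ) (hf : ∀ u : ℤ, u < d → f.coeff u = 0)
    (hn : 0 < n) (hnd : n < d) : hk f n = 0 := by
  unfold hk
  refine Matrix.det_eq_zero_of_row_eq_zero ⟨0, hn⟩ fun j => ?_
  simp only [Matrix.of_apply]
  exact hf _ (by have := j.2; push_cast; omega)

/-- sign of the reversal -/
def rv (n : ℕ) : K := ((Equiv.Perm.sign (Fin.revPerm : Equiv.Perm (Fin n)) : ℤ) : K)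

lemma rv_ne (n : ℕ) : rv (K := K) n ≠ 0 := by
  unfold rv
  rcases Int.units_eq_one_or (Equiv.Perm.sign (Fin.revPerm : Equiv.Perm (Fin n))) with h | h <;>
    simp [h]

lemma hk_diag (f : LaurentSeries K) (d : ℕ) (hf : ∀ u : ℤ, u < d → f.coeff u = 0) :
    hk f d = rv d * (f.coeff d) ^ d := by
  unfold hk rv
  have := Matrix.det_permute (R := K) (Fin.revPerm : Equiv.Perm (Fin d))
    (Matrix.of fun i j : Fin d => f.coeff ((d : ℤ) - ((i : ℕ) : ℤ) + ((j : ℕ) : ℤ)))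
  rw [Matrix.det_of_upperTriangular (M := (Matrix.of fun i j : Fin d =>
    f.coeff ((d : ℤ) - ((i : ℕ) : ℤ) + ((j : ℕ) : ℤ))))] at this
  · simp only [Matrix.of_apply, sub_add_cancel, Finset.prod_const, Finset.card_univ,
      Fintype.card_fin] at this
    rw [← this]
    congr 1
    ext i j
    simp only [Matrix.submatrix_apply, Matrix.of_apply, Fin.revPerm_apply, Fin.val_rev, id]
    congr 1
    have := i.2
    omega
  · intro i j hij
    have hij' : (j : ℕ) < i := hij
    simp only [Matrix.of_apply]
    exact hf _ (by omega)

lemma rv_succ (n : ℕ) : rv (K := K) (n + 1) = (-1) ^ n * rv n := by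
  have h : ∀ n, rv (K := K) n = (Matrix.of fun i j : Fin n =>
      if (i : ℕ) + j + 1 = n then (1 : K) else 0).det := by
    intro n
    have := Matrix.det_permute (R := K) (Fin.revPerm : Equiv.Perm (Fin n)) 1
    rw [Matrix.det_one, mul_one] at this
    unfold rv
    rw [← this]
    congr 1
    ext i j
    simp only [Matrix.submatrix_apply, Matrix.of_apply, Fin.revPerm_apply, id, Matrix.one_apply,
      Fin.ext_iff, Fin.val_rev]
    have := i.2
    congr 1
    simp only [eq_iff_iff]
    omega
  rw [h, h, Matrix.det_succ_row_zero, Finset.sum_eq_single (Fin.last n)]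
  · simp only [Fin.val_last, Matrix.of_apply, Fin.val_zero, zero_add, if_true, mul_one]
    congr 2
    ext i j
    simp only [Matrix.submatrix_apply, Matrix.of_apply, Fin.val_succ, Fin.succAbove_last,
      Fin.val_castSucc]
    congr 1
    simp only [eq_iff_iff]
    omega
  · intro b _ hb
    have : (b : ℕ) ≠ n := fun h => hb (Fin.ext h)
    simp [this]
  · simp

lemma rv_four (n : ℕ) : rv (K := K) (n + 4) = rv n := by
  rw [rv_succ, rv_succ, rv_succ, rv_succ]
  have : ((-1 : K) ^ n) * (-1) ^ n = 1 := by rw [← mul_pow]; simp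
  simp only [pow_succ]
  linear_combination (rv n * ((-1 : K) ^ n * (-1) ^ n) + rv n) * this

lemma rv_four_mul (n k : ℕ) : rv (K := K) (n + 4 * k) = rv n := by
  induction k with
  | zero => simp
  | succ k ih => rw [show n + 4 * (k + 1) = n + 4 * k + 4 by ring, rv_four, ih]

lemma tLS_pow_mul_coeff (f : LaurentSeries K) (k : ℕ) (u : ℤ) :
    (tLS K ^ k * f).coeff u = f.coeff (u + k) := by
  rw [tLS, HahnSeries.single_pow, one_pow, HahnSeries.coeff_single_mul, one_mul]
  congr 1
  simp

lemma seriesOf_coeff (S : ℕ → K) (u : ℕ) : (seriesOf S).coeff (1 + (u : ℤ)) = S u := by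
  rw [seriesOf, HahnSeries.coeff_single_mul, one_mul,
    show (1 + (u : ℤ) - 1) = ((u : ℕ) : ℤ) by ring, HahnSeries.ofPowerSeries_apply_coeff]
  simp

lemma wall_hk (S : ℕ → K) (k m : ℕ) :
    wallEntry (extendSeq S) m ((m : ℤ) + k) =
      rv (m + 1) * hk (tLS K ^ k * seriesOf S) (m + 1) := by
  unfold hk rv
  rw [← Matrix.det_permute]
  unfold wallEntry
  congr 1
  ext i j
  have hi := i.2
  simp only [Matrix.submatrix_apply, Matrix.of_apply, Fin.revPerm_apply, id, Fin.val_rev,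
    tLS_pow_mul_coeff]
  rw [show (1 + ((m + 1 - ((i : ℕ) + 1) : ℕ) : ℤ) + ((j : ℕ) : ℤ) + k) =
    1 + ((m - (i : ℕ) + j + k : ℕ) : ℤ) by push_cast; omega, seriesOf_coeff]
  unfold extendSeq
  rw [if_pos (by omega)]
  congr 1
  omega

open scoped RatFunc in
lemma algMap_K (c : K) :
    algebraMap K (LaurentSeries K) c = HahnSeries.single (0:ℤ) c := by
  rw [HahnSeries.algebraMap_apply']
  simp

lemma aeval_tLS_coeff (p : K[X]) (u : ℤ) :
    (Polynomial.aeval (tLS K) p).coeff u = if u ≤ 0 then p.coeff (-u).toNat else 0 := by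
  induction p using Polynomial.induction_on' with
  | add p q hp hq =>
    rw [map_add, HahnSeries.coeff_add, hp, hq]
    split_ifs <;> simp
  | monomial n c =>
    rw [Polynomial.aeval_monomial, tLS, HahnSeries.single_pow, one_pow,
      algMap_K]
    simp only [HahnSeries.single_mul_single, Polynomial.coeff_monomial,
      HahnSeries.coeff_single]
    simp
    split_ifs <;> first | rfl | omega

lemma polyPart_coeff (f : LaurentSeries K) (u : ℤ) :
    (polyPart f).coeff u = if u ≤ 0 then f.coeff u else 0 := rfl

lemma polyPart_eq_aeval (f : LaurentSeries K) :
    ∃ p : K[X], Polynomial.aeval (tLS K) p = polyPart f := by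
  refine ⟨∑ i ∈ Finset.range ((-f.order).toNat + 1),
    Polynomial.monomial i (f.coeff (-(i : ℤ))), ?_⟩
  ext u
  rw [aeval_tLS_coeff, polyPart_coeff]
  split_ifs with hu
  · simp only [Polynomial.finsetSum_coeff, Polynomial.coeff_monomial]
    rw [Finset.sum_ite_eq']
    split_ifs with h
    · congr 1; omega
    · simp only [Finset.mem_range, not_lt] at h
      exact (HahnSeries.coeff_eq_zero_of_lt_order (by omega)).symm
  · rfl

open scoped RatFunc in
/-- the subfield of rational series -/
def ratSub (K : Type*) [Field K] : Subfield (LaurentSeries K) :=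
  (algebraMap (RatFunc K) (LaurentSeries K)).fieldRange

open scoped RatFunc in
lemma isRat_iff (f : LaurentSeries K) : IsRatLS f ↔ f ∈ ratSub K := by
  rw [ratSub, RingHom.mem_fieldRange]
  rfl

lemma tLS_mem : tLS K ∈ ratSub K := by
  have h : (HahnSeries.single (1 : ℤ) (1 : K) : LaurentSeries K) ∈ ratSub K := by
    rw [← isRat_iff]
    exact ⟨RatFunc.X, RatFunc.coe_X⟩
  have h2 : tLS K = (HahnSeries.single (1 : ℤ) (1 : K) : LaurentSeries K)⁻¹ := by
    rw [tLS]
    refine eq_inv_of_mul_eq_one_left ?_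
    simp
  rw [h2]
  exact inv_mem h

lemma tLS_ne : tLS K ≠ 0 := by
  rw [tLS]; simp

open scoped RatFunc in
lemma aeval_mem (p : K[X]) : Polynomial.aeval (tLS K) p ∈ ratSub K := by
  induction p using Polynomial.induction_on' with
  | add p q hp hq => rw [map_add]; exact add_mem hp hq
  | monomial n c =>
    rw [Polynomial.aeval_monomial]
    refine mul_mem ?_ (pow_mem tLS_mem n)
    rw [← isRat_iff]
    refine ⟨algebraMap K (RatFunc K) c, ?_⟩
    rw [IsScalarTower.algebraMap_apply K (Polynomial K) (RatFunc K),
      ← IsScalarTower.algebraMap_apply (Polynomial K) (RatFunc K) (LaurentSeries K), algMap_K,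
      HahnSeries.algebraMap_apply']
    simp [PowerSeries.algebraMap_apply']

lemma cfQuot_irr (f : LaurentSeries K) (hf : ¬ IsRatLS f) (i : ℕ) : ¬ IsRatLS (cfQuot f i) := by
  induction i with
  | zero => exact hf
  | succ i ih =>
    rw [isRat_iff] at ih ⊢
    intro h
    rw [cfQuot, inv_mem_iff] at h
    apply ih
    obtain ⟨p, hp⟩ := polyPart_eq_aeval (cfQuot f i)
    rw [← hp] at h
    have := add_mem h (aeval_mem p)
    simpa using this

lemma frac_ne (f : LaurentSeries K) (hf : ¬ IsRatLS f) (i : ℕ) :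
    cfQuot f i - polyPart (cfQuot f i) ≠ 0 := by
  intro h
  have := cfQuot_irr f hf (i + 1)
  rw [cfQuot, h, inv_zero, isRat_iff] at this
  exact this (zero_mem _)

/-- vanishing below `N` -/
def VGe (N : ℤ) (x : LaurentSeries K) : Prop := ∀ u, u < N → x.coeff u = 0

lemma VGe.add {N : ℤ} {x y : LaurentSeries K} (hx : VGe N x) (hy : VGe N y) : VGe N (x + y) := by
  intro u hu
  rw [HahnSeries.coeff_add, hx u hu, hy u hu, add_zero]

lemma VGe.neg {N : ℤ} {x : LaurentSeries K} (hx : VGe N x) : VGe N (-x) := by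
  intro u hu
  rw [HahnSeries.coeff_neg, hx u hu, neg_zero]

lemma VGe.mono {N M : ℤ} {x : LaurentSeries K} (hx : VGe N x) (h : M ≤ N) : VGe M x :=
  fun u hu => hx u (by omega)

lemma VGe.mul {N M : ℤ} {x y : LaurentSeries K} (hx : VGe N x) (hy : VGe M y) :
    VGe (N + M) (x * y) := by
  intro u hu
  rw [conv_coeff x y u ∅]
  · simp
  · intro v h1 h2
    exfalso
    have : N ≤ v := by
      by_contra hc; exact h1 (hx v (by omega))
    exact h2 (hy _ (by omega))

lemma VGe.sqrt {N : ℤ} {x : LaurentSeries K} (hx : VGe (N + N) (x * x)) : VGe N x := by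
  intro u hu
  by_contra h
  have hx0 : x ≠ 0 := by rintro rfl; simp at h
  have h1 : x.order ≤ u := HahnSeries.order_le_of_coeff_ne_zero h
  have h2 : (x * x).order = x.order + x.order := HahnSeries.order_mul hx0 hx0
  have h3 : (x * x).coeff (x * x).order ≠ 0 :=
    HahnSeries.coeff_order_eq_zero.not.mpr (mul_ne_zero hx0 hx0)
  exact h3 (hx _ (by omega))

lemma VGe_frac (f : LaurentSeries K) : VGe 1 (f - polyPart f) := by
  intro u hu
  rw [HahnSeries.coeff_sub, polyPart_coeff, if_pos (by omega), sub_self]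

/-- bounded quadratic equation -/
def QB (B : ℕ) (Δ : LaurentSeries K) (x : LaurentSeries K) : Prop :=
  ∃ a b c : K[X], (a ≠ 0 ∨ b ≠ 0 ∨ c ≠ 0) ∧ VGe (-B) (aeval (tLS K) a) ∧
    VGe (-B) (aeval (tLS K) b) ∧ VGe (-B) (aeval (tLS K) c) ∧
    aeval (tLS K) b ^ 2 - 4 * aeval (tLS K) a * aeval (tLS K) c = Δ ∧
    aeval (tLS K) a * x ^ 2 + aeval (tLS K) b * x + aeval (tLS K) c = 0

lemma QB_step (B : ℕ) (Δ x : LaurentSeries K) (hΔ : VGe (-B + -B) Δ) (h : QB B Δ x)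
    (hx : x - polyPart x ≠ 0) : QB B Δ (x - polyPart x)⁻¹ := by
  obtain ⟨a, b, c, hne, ha, hb, hc, hD, he⟩ := h
  obtain ⟨p, hp⟩ := polyPart_eq_aeval x
  have hφ := VGe_frac x
  rw [← hp] at hφ hx ⊢
  set φ := x - aeval (tLS K) p with hφd
  have hxe : x = aeval (tLS K) p + φ := by rw [hφd]; ring
  set e := 2 * aeval (tLS K) a * x + aeval (tLS K) b with hed
  have hee : e * e = Δ := by
    rw [← hD, hed]
    linear_combination 4 * aeval (tLS K) a * he
  have heB : VGe (-B) e := VGe.sqrt (by rw [hee]; exact hΔ)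
  have ha' : VGe (-B) (aeval (tLS K) (a * p ^ 2 + b * p + c)) := by
    have : aeval (tLS K) (a * p ^ 2 + b * p + c) = -(φ * e) + φ * (φ * aeval (tLS K) a) := by
      simp only [map_add, map_mul, map_pow]
      rw [hed, hφd]
      linear_combination he
    rw [this]
    refine VGe.add (VGe.neg ((hφ.mul heB).mono (by omega))) ((hφ.mul (hφ.mul ha)).mono (by omega))
  have hD' : aeval (tLS K) (2 * a * p + b) ^ 2 - 4 * aeval (tLS K) (a * p ^ 2 + b * p + c) *
      aeval (tLS K) a = Δ := by
    rw [← hD]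
    simp only [map_add, map_mul, map_pow, map_ofNat]
    ring
  refine ⟨a * p ^ 2 + b * p + c, 2 * a * p + b, a, ?_, ha', ?_, ha, hD', ?_⟩
  · by_contra hcon
    push Not at hcon
    obtain ⟨h1, h2, h3⟩ := hcon
    subst h3
    simp at h2
    subst h2
    simp at h1
    subst h1
    simp at hne
  · refine VGe.sqrt ?_
    have h1 := ha'.mul ha
    have : aeval (tLS K) (2 * a * p + b) * aeval (tLS K) (2 * a * p + b) = Δ +
      ((aeval (tLS K) (a * p ^ 2 + b * p + c) * aeval (tLS K) a +
        aeval (tLS K) (a * p ^ 2 + b * p + c) * aeval (tLS K) a) +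
      (aeval (tLS K) (a * p ^ 2 + b * p + c) * aeval (tLS K) a +
        aeval (tLS K) (a * p ^ 2 + b * p + c) * aeval (tLS K) a)) := by
      linear_combination hD'
    rw [this]
    exact hΔ.add ((h1.add h1).add (h1.add h1))
  · simp only [map_add, map_mul, map_pow, map_ofNat]
    rw [hxe] at he
    field_simp
    linear_combination he

lemma VGe_aeval_iff (B : ℕ) (p : K[X]) :
    VGe (-B) (aeval (tLS K) p) ↔ p ∈ Polynomial.degreeLT K (B + 1) := by
  rw [Polynomial.mem_degreeLT, Polynomial.degree_lt_iff_coeff_zero]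
  constructor
  · intro h m hm
    have := h (-(m : ℤ)) (by omega)
    rw [aeval_tLS_coeff, if_pos (by omega)] at this
    simpa using this
  · intro h u hu
    rw [aeval_tLS_coeff, if_pos (by omega)]
    exact h _ (by omega)

lemma aeval_inj (p : K[X]) (h : aeval (tLS K) p = 0) : p = 0 := by
  ext n
  have := aeval_tLS_coeff p (-(n : ℤ))
  rw [h, if_pos (by omega)] at this
  simpa using this.symm

lemma QB_finite [Finite K] (B : ℕ) (Δ : LaurentSeries K) : {x | QB B Δ x}.Finite := by
  have hF : (Polynomial.degreeLT K (B + 1) : Set K[X]).Finite := by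
    have : Finite (Polynomial.degreeLT K (B + 1)) :=
      Finite.of_equiv _ (Polynomial.degreeLTEquiv K (B + 1)).toEquiv.symm
    exact Set.toFinite _
  let P : K[X] × K[X] × K[X] → (LaurentSeries K)[X] := fun t =>
    C (aeval (tLS K) t.1) * X ^ 2 + C (aeval (tLS K) t.2.1) * X + C (aeval (tLS K) t.2.2)
  have hfin := (hF.prod (hF.prod hF)).biUnion
    (t := fun t => {x | P t ≠ 0 ∧ (P t).IsRoot x}) (by
      intro t _
      by_cases h : P t = 0
      · simp [h]
      · exact (Polynomial.finite_setOf_isRoot h).subset fun x hx => hx.2)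
  refine hfin.subset ?_
  rintro x ⟨a, b, c, hne, ha, hb, hc, -, he⟩
  simp only [Set.mem_iUnion]
  refine ⟨(a, b, c), ⟨(VGe_aeval_iff B a).1 ha, (VGe_aeval_iff B b).1 hb,
    (VGe_aeval_iff B c).1 hc⟩, ?_, ?_⟩
  · intro h0
    have c2 := congrArg (fun q => q.coeff 2) h0
    have c1 := congrArg (fun q => q.coeff 1) h0
    have c0 := congrArg (fun q => q.coeff 0) h0
    simp [P, Polynomial.coeff_X, Polynomial.coeff_C] at c2 c1 c0
    rcases hne with h | h | h
    · exact h (aeval_inj _ c2)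
    · exact h (aeval_inj _ c1)
    · exact h (aeval_inj _ c0)
  · simp only [P, Polynomial.IsRoot.def, Polynomial.eval_add, Polynomial.eval_mul,
      Polynomial.eval_C, Polynomial.eval_pow, Polynomial.eval_X]
    exact he

lemma cf_finite [Finite K] (f : LaurentSeries K) (hf : IsQuadIrr f) :
    (Set.range (cfQuot f)).Finite := by
  obtain ⟨hirr, a, b, c, ha, he⟩ := hf
  set B := a.natDegree + b.natDegree + c.natDegree with hB
  have hdeg : ∀ p : K[X], p.natDegree ≤ B → VGe (-B) (aeval (tLS K) p) := by
    intro p hp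
    rw [VGe_aeval_iff, Polynomial.mem_degreeLT]
    refine lt_of_le_of_lt Polynomial.degree_le_natDegree ?_
    exact_mod_cast Nat.lt_succ_of_le hp
  have h1 := hdeg a (by omega)
  have h2 := hdeg b (by omega)
  have h3 := hdeg c (by omega)
  refine (QB_finite B (aeval (tLS K) b ^ 2 - 4 * aeval (tLS K) a * aeval (tLS K) c)).subset ?_
  rintro _ ⟨i, rfl⟩
  induction i with
  | zero => exact ⟨a, b, c, Or.inl ha, h1, h2, h3, rfl, he⟩
  | succ i ih =>
    refine QB_step _ _ _ ?_ ih (frac_ne f hirr i)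
    have h4 := h1.mul h3
    have : aeval (tLS K) b ^ 2 - 4 * aeval (tLS K) a * aeval (tLS K) c =
      aeval (tLS K) b * aeval (tLS K) b +
      (-((aeval (tLS K) a * aeval (tLS K) c + aeval (tLS K) a * aeval (tLS K) c) +
        (aeval (tLS K) a * aeval (tLS K) c + aeval (tLS K) a * aeval (tLS K) c))) := by ring
    rw [this]
    exact (h2.mul h2).add (((h4.add h4).add (h4.add h4)).neg)

lemma quad_tpow (f : LaurentSeries K) (hf : IsQuadIrr f) (k : ℕ) : IsQuadIrr (tLS K ^ k * f) := by
  obtain ⟨hirr, a, b, c, ha, he⟩ := hf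
  refine ⟨?_, a, b * X ^ k, c * X ^ (2 * k), ha, ?_⟩
  · rw [isRat_iff] at hirr ⊢
    intro h
    apply hirr
    have := mul_mem (inv_mem (pow_mem (tLS_mem (K := K)) k)) h
    rwa [inv_mul_cancel_left₀ (pow_ne_zero _ tLS_ne)] at this
  · simp only [map_mul, map_pow, aeval_X]
    linear_combination (tLS K) ^ (2 * k) * he

lemma cf_step [Fintype K] (α : LaurentSeries K) (hα : ¬ IsRatLS α) (i : ℕ) :
    ∃ d : ℕ, 1 ≤ d ∧ degZ (cfPQ α (i + 1)) = d ∧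
      (∀ n, 0 < n → n < d → hk (cfQuot α i) n = 0) ∧
      ∃ c : ℕ → K, (∀ n, c n ≠ 0) ∧ (∀ n, c (n + 2 * (Fintype.card K - 1)) = c n) ∧
        ∀ n, hk (cfQuot α i) (d + n) = c n * hk (cfQuot α (i + 1)) n := by
  have hf0 := frac_ne α hα i
  have hV := VGe_frac (cfQuot α i)
  have hhk : ∀ n, hk (cfQuot α i) n = hk (cfQuot α i - polyPart (cfQuot α i)) n := by
    intro n
    unfold hk
    congr 1
    ext a b
    simp only [Matrix.of_apply]
    rw [HahnSeries.coeff_sub, polyPart_coeff, if_neg (by omega), sub_zero]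
  have hβ : cfQuot α (i + 1) = (cfQuot α i - polyPart (cfQuot α i))⁻¹ := rfl
  set f := cfQuot α i - polyPart (cfQuot α i) with hf
  set β := cfQuot α (i + 1) with hβd
  have hβ0 : β ≠ 0 := by rw [hβ]; exact inv_ne_zero hf0
  have hfβ : f * β = 1 := by rw [hβ]; exact mul_inv_cancel₀ hf0
  have hord : f.order + β.order = 0 := by
    rw [← HahnSeries.order_mul hf0 hβ0, hfβ, HahnSeries.order_one]
  have hfo : f.coeff f.order ≠ 0 := HahnSeries.coeff_order_eq_zero.not.mpr hf0
  have hβo : β.coeff β.order ≠ 0 := HahnSeries.coeff_order_eq_zero.not.mpr hβ0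
  have h1 : 1 ≤ f.order := by
    by_contra h
    exact hfo (hV _ (by omega))
  obtain ⟨d, hd⟩ : ∃ d : ℕ, f.order = d := ⟨f.order.toNat, by omega⟩
  have hβd' : β.order = -(d : ℤ) := by omega
  rw [hd] at hfo
  rw [hβd'] at hβo
  have hflt : ∀ u : ℤ, u < d → f.coeff u = 0 := fun u hu =>
    HahnSeries.coeff_eq_zero_of_lt_order (by omega)
  have hβlt : ∀ u : ℤ, u < -d → β.coeff u = 0 := fun u hu =>
    HahnSeries.coeff_eq_zero_of_lt_order (by omega)
  refine ⟨d, by omega, ?_, ?_, fun n => hk f d * ((-1) ^ n * (f.coeff d / β.coeff (-d)) ^ n),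
    ?_, ?_, ?_⟩
  · have hc : (polyPart β).coeff (-d) ≠ 0 := by
      rw [polyPart_coeff, if_pos (by omega)]; exact hβo
    have hp0 : polyPart β ≠ 0 := by
      intro h; rw [h] at hc; simp at hc
    have a1 : (polyPart β).order ≤ -d := HahnSeries.order_le_of_coeff_ne_zero hc
    have a2 : (polyPart β).coeff (polyPart β).order ≠ 0 :=
      HahnSeries.coeff_order_eq_zero.not.mpr hp0
    have a3 : -(d : ℤ) ≤ (polyPart β).order := by
      by_contra h
      apply a2
      rw [polyPart_coeff, hβlt _ (by omega)]
      simp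
    change -(polyPart β).order = d
    omega
  · intro n h0 hn
    rw [hhk]
    exact hk_small f d n hflt h0 hn
  · intro n
    refine mul_ne_zero ?_ (mul_ne_zero ?_ ?_)
    · rw [hk_diag f d hflt]
      exact mul_ne_zero (rv_ne d) (pow_ne_zero _ hfo)
    · exact pow_ne_zero _ (neg_ne_zero.mpr one_ne_zero)
    · exact pow_ne_zero _ (div_ne_zero hfo hβo)
  · intro n
    simp only
    rw [pow_add, pow_add, pow_mul (-1 : K)]
    have := FiniteField.pow_card_sub_one_eq_one (f.coeff d / β.coeff (-d)) (div_ne_zero hfo hβo)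
    rw [mul_comm 2 (Fintype.card K - 1), pow_mul, this]
    simp
  · intro n
    rw [hhk]
    have := hk_step f β d n hfβ hflt hβlt
    simp only
    rw [div_pow]
    field_simp
    linear_combination this

lemma cf_struct [Fintype K] (α : LaurentSeries K) (hα : ¬ IsRatLS α) :
    ∃ d : ℕ → ℕ, (∀ i, 1 ≤ d i) ∧ (∀ i, degZ (cfPQ α (i + 1)) = d i) ∧
      (∀ i n, ∑ j ∈ Finset.range i, d j < n → n < ∑ j ∈ Finset.range (i + 1), d j →
        hk α n = 0) ∧
      ∃ C : ℕ → ℕ → K, (∀ i n, C i n ≠ 0) ∧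
        (∀ i n, C i (n + 2 * (Fintype.card K - 1)) = C i n) ∧
        ∀ i n, hk α (∑ j ∈ Finset.range i, d j + n) = C i n * hk (cfQuot α i) n := by
  choose d hd1 hd2 hd3 c hc1 hc2 hc3 using cf_step α hα
  let C : ℕ → ℕ → K := fun i => Nat.rec (fun _ => 1) (fun i Ci n => Ci (d i + n) * c i n) i
  have hC : ∀ i n, C (i + 1) n = C i (d i + n) * c i n := fun i n => rfl
  have h1 : ∀ i n, C i n ≠ 0 := by
    intro i
    induction i with
    | zero => intro n; exact one_ne_zero
    | succ i ih => intro n; rw [hC]; exact mul_ne_zero (ih _) (hc1 _ _)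
  have h2 : ∀ i n, C i (n + 2 * (Fintype.card K - 1)) = C i n := by
    intro i
    induction i with
    | zero => intro n; rfl
    | succ i ih => intro n; rw [hC, hC, ← add_assoc, ih, hc2]
  have h3 : ∀ i n, hk α (∑ j ∈ Finset.range i, d j + n) = C i n * hk (cfQuot α i) n := by
    intro i
    induction i with
    | zero => intro n; simp [C, cfQuot]
    | succ i ih =>
      intro n
      rw [Finset.sum_range_succ, add_assoc, ih, hc3, hC]
      ring
  refine ⟨d, hd1, hd2, ?_, C, h1, h2, h3⟩
  intro i n h h'
  rw [Finset.sum_range_succ] at h'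
  obtain ⟨r, rfl⟩ := Nat.exists_eq_add_of_lt h
  rw [add_assoc, h3, hd3 _ _ (by omega) (by omega), mul_zero]

lemma periodic_mod {A : Type*} (F : ℕ → A) (M : ℕ) (h : ∀ n, F (n + M) = F n) (n : ℕ) :
    F n = F (n % M) := by
  exact (Function.Periodic.map_mod_nat (f := F) h n).symm

lemma hk_periodic [Fintype K] (α : LaurentSeries K) (hα : IsQuadIrr α) :
    ∃ N ℓ : ℕ, 1 ≤ ℓ ∧ ∀ n, N ≤ n → hk α (n + ℓ) = hk α n := by
  obtain ⟨d, hd1, -, -, C, -, hC2, hC3⟩ := cf_struct α hα.1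
  have hfin := cf_finite α hα
  have hM : 0 < 2 * (Fintype.card K - 1) := by
    have := Fintype.one_lt_card (α := K)
    omega
  set M := 2 * (Fintype.card K - 1) with hMd
  have : Finite (Set.range (cfQuot α)) := hfin
  obtain ⟨i, j, hij, he⟩ := Finite.exists_ne_map_eq_of_infinite
    (fun i : ℕ => ((⟨cfQuot α i, i, rfl⟩ : Set.range (cfQuot α)), fun r : Fin M => C i r))
  wlog hlt : i < j generalizing i j
  · exact this j i hij.symm he.symm (by omega)
  simp only [Prod.mk.injEq] at he
  obtain ⟨e1, e2⟩ := he
  replace e1 : cfQuot α i = cfQuot α j := congrArg Subtype.val e1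
  have e3 : ∀ n, C i n = C j n := by
    intro n
    rw [periodic_mod (C i) M (hC2 i) n, periodic_mod (C j) M (hC2 j) n]
    exact congrFun e2 ⟨n % M, Nat.mod_lt _ hM⟩
  have hD : ∑ l ∈ Finset.range i, d l < ∑ l ∈ Finset.range j, d l := by
    rw [← Finset.sum_range_add_sum_Ico d hlt.le]
    have : 0 < ∑ l ∈ Finset.Ico i j, d l :=
      Finset.sum_pos (fun l _ => hd1 l) ⟨i, by simp [hlt]⟩
    omega
  refine ⟨∑ l ∈ Finset.range i, d l,
    ∑ l ∈ Finset.range j, d l - ∑ l ∈ Finset.range i, d l, by omega, ?_⟩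
  intro n hn
  obtain ⟨r, rfl⟩ := Nat.exists_eq_add_of_le hn
  rw [hC3, e1, e3, ← hC3]
  congr 1
  omega

lemma cf_window [Fintype K] (α : LaurentSeries K) (hα : IsQuadIrr α) :
    ∃ s : ℕ × ℕ, PeriodWindow α s.1 s.2 := by
  have : Finite (Set.range (cfQuot α)) := cf_finite α hα
  obtain ⟨i, j, hij, he⟩ := Finite.exists_ne_map_eq_of_infinite
    (fun i : ℕ => (⟨cfQuot α i, i, rfl⟩ : Set.range (cfQuot α)))
  wlog hlt : i < j generalizing i j
  · exact this j i hij.symm he.symm (by omega)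
  replace he : cfQuot α i = cfQuot α j := congrArg Subtype.val he
  have h : ∀ n, cfQuot α (i + n) = cfQuot α (j + n) := by
    intro n
    induction n with
    | zero => exact he
    | succ n ih =>
      change (cfQuot α (i + n) - polyPart (cfQuot α (i + n)))⁻¹ = _
      rw [ih]; rfl
  refine ⟨(i, j - i), by simp; omega, ?_⟩
  intro n hn
  simp only at hn ⊢
  have := h (n - i)
  unfold cfPQ
  rw [show n + (j - i) = j + (n - i) by omega, ← this]
  congr 2
  omega

lemma win_shift (u : ℕ → ℝ) (i₀ ℓ : ℕ) (hu : ∀ i, i₀ ≤ i → u (i + ℓ) = u i) (N : ℕ)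
    (hN : i₀ ≤ N) : ∑ i ∈ Finset.range ℓ, u (N + i) = ∑ i ∈ Finset.range ℓ, u (i₀ + i) := by
  induction N, hN using Nat.le_induction with
  | base => rfl
  | succ n hn ih =>
    rw [← ih]
    have h1 := Finset.sum_range_succ (fun i => u (n + i)) ℓ
    have h2 := Finset.sum_range_succ' (fun i => u (n + i)) ℓ
    rw [hu n hn] at h1
    simp only [add_zero] at h2
    rw [h1] at h2
    have h3 := add_right_cancel h2
    rw [h3]
    refine Finset.sum_congr rfl fun i _ => ?_
    congr 1; ring

lemma win_mul (u : ℕ → ℝ) (i₀ ℓ : ℕ) (hu : ∀ i, i₀ ≤ i → u (i + ℓ) = u i) (N k : ℕ)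
    (hN : i₀ ≤ N) :
    ∑ i ∈ Finset.range (k * ℓ), u (N + i) = k * ∑ i ∈ Finset.range ℓ, u (i₀ + i) := by
  induction k with
  | zero => simp
  | succ k ih =>
    rw [show (k + 1) * ℓ = k * ℓ + ℓ by ring, Finset.sum_range_add, ih]
    have := win_shift u i₀ ℓ hu (N + k * ℓ) (by omega)
    simp only [← add_assoc]
    rw [this]
    push_cast
    ring

lemma win_eq (u : ℕ → ℝ) (i₀ ℓ i₁ ℓ' : ℕ) (hu : ∀ i, i₀ ≤ i → u (i + ℓ) = u i)
    (hu' : ∀ i, i₁ ≤ i → u (i + ℓ') = u i) :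
    (ℓ' : ℝ) * ∑ i ∈ Finset.range ℓ, u (i₀ + i) = ℓ * ∑ i ∈ Finset.range ℓ', u (i₁ + i) := by
  rw [← win_mul u i₀ ℓ hu (max i₀ i₁) ℓ' (le_max_left _ _),
    ← win_mul u i₁ ℓ' hu' (max i₀ i₁) ℓ (le_max_right _ _), mul_comm]

lemma ratio_eq [Fintype K] (α : LaurentSeries K) (hα : IsQuadIrr α) (h : ℕ → ℕ) (ℓ : ℕ)
    (hℓ : 1 ≤ ℓ) (hmono : ∀ i, i < ℓ → h i < h (i + 1))
    (hnz : ∀ i, i ≤ ℓ → hk α (h i + 1) ≠ 0)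
    (hz : ∀ i, i < ℓ → ∀ m, h i < m → m < h (i + 1) → hk α (m + 1) = 0)
    (hper : ∀ m, h 0 ≤ m → (hk α (m + (h ℓ - h 0) + 1) = 0 ↔ hk α (m + 1) = 0)) (n : ℕ) :
    eMassOf α n = (∑ i ∈ Finset.Icc 1 ℓ, max (((h i : ℝ) - (h (i - 1) : ℝ)) - (n : ℝ)) 0) /
      ((h ℓ : ℝ) - (h 0 : ℝ)) := by
  obtain ⟨d, hd1, hd2, hd3, C, hC1, hC2, hC3⟩ := cf_struct α hα.1
  set D : ℕ → ℕ := fun i => ∑ j ∈ Finset.range i, d j with hD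
  have hDs : ∀ i, D (i + 1) = D i + d i := fun i => Finset.sum_range_succ d i
  have hDm : StrictMono D := strictMono_nat_of_lt_succ fun i => by
    rw [hDs]; have := hd1 i; omega
  have hDn : ∀ i, hk α (D i) ≠ 0 := by
    intro i
    have := hC3 i 0
    rw [add_zero, hk_zero, mul_one] at this
    change hk α (∑ j ∈ Finset.range i, d j) ≠ 0
    rw [this]; exact hC1 i 0
  have hDr : ∀ x, hk α x ≠ 0 → ∃ i, D i = x := by
    intro x hx
    by_contra hcon
    push Not at hcon
    have h0 : D 0 ≤ x := by simp [hD]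
    have hex : ∃ i, x < D i := ⟨x + 1, lt_of_lt_of_le (Nat.lt_succ_self x) (hDm.id_le _)⟩
    have h1 := Nat.find_spec hex
    have hne : Nat.find hex ≠ 0 := by
      intro h; rw [h] at h1; omega
    obtain ⟨j, hj⟩ := Nat.exists_eq_succ_of_ne_zero hne
    have h2 := Nat.find_min hex (m := j) (by omega)
    rw [hj] at h1
    exact hx (hd3 j x (lt_of_le_of_ne (not_lt.1 h2) (hcon j)) h1)
  obtain ⟨i₀, hi₀⟩ := hDr _ (hnz 0 (by omega))
  have hnext : ∀ i j, i < j → D (i + 1) ≤ D j := fun i j hij => hDm.monotone hij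
  have hh : ∀ j, j ≤ ℓ → D (i₀ + j) = h j + 1 := by
    intro j
    induction j with
    | zero => intro _; exact hi₀
    | succ j ih =>
      intro hj
      have ihj := ih (by omega)
      obtain ⟨r, hr⟩ := hDr _ (hnz (j + 1) hj)
      have hm := hmono j (by omega)
      have hlt : i₀ + j < r := hDm.lt_iff_lt.1 (by omega)
      have h1 := hnext _ _ hlt
      have h2 := hDm (Nat.lt_add_one (i₀ + j))
      rw [← add_assoc]
      by_contra hne
      have h3 := hz j (by omega) (D (i₀ + j + 1) - 1) (by omega) (by omega)
      rw [Nat.sub_add_cancel (by omega)] at h3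
      exact hDn _ h3
  have hp : h 0 < h ℓ := by
    have := hDm (show i₀ < i₀ + ℓ by omega)
    rw [hh ℓ le_rfl, hi₀] at this
    omega
  have hper' : ∀ x, D i₀ ≤ x → (hk α (x + (h ℓ - h 0)) = 0 ↔ hk α x = 0) := by
    intro x hx
    have := hper (x - 1) (by omega)
    rw [show x - 1 + (h ℓ - h 0) + 1 = x + (h ℓ - h 0) by omega,
      Nat.sub_add_cancel (by omega)] at this
    exact this
  have hDp : ∀ i, i₀ ≤ i → D (i + ℓ) = D i + (h ℓ - h 0) := by
    intro i hi
    induction i, hi using Nat.le_induction with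
    | base => rw [hh ℓ le_rfl, hi₀]; omega
    | succ i hi ih =>
      have hDi : D i₀ ≤ D i := hDm.monotone hi
      have h2 := hDm (Nat.lt_add_one i)
      have h3 := hDm (Nat.lt_add_one (i + ℓ))
      obtain ⟨r, hr⟩ := hDr (D (i + 1) + (h ℓ - h 0)) (by
        rw [Ne, hper' _ (by omega)]; exact hDn _)
      have h4 := hnext (i + ℓ) r (hDm.lt_iff_lt.1 (by omega))
      obtain ⟨r', hr'⟩ := hDr (D (i + ℓ + 1) - (h ℓ - h 0)) (by
        rw [Ne, ← hper' _ (by omega), Nat.sub_add_cancel (by omega)]; exact hDn _)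
      have h5 := hnext i r' (hDm.lt_iff_lt.1 (by omega))
      rw [show i + 1 + ℓ = i + ℓ + 1 by ring]
      omega
  have hdp : ∀ i, i₀ ≤ i → d (i + ℓ) = d i := by
    intro i hi
    have h1 := hDp i hi
    have h2 := hDp (i + 1) (by omega)
    rw [show i + 1 + ℓ = i + ℓ + 1 by ring, hDs, hDs] at h2
    omega
  have hex := cf_window α hα
  unfold eMassOf
  rw [dif_pos hex]
  obtain ⟨hw1, hw2⟩ := Classical.choose_spec hex
  set m₀ := (Classical.choose hex).1
  set ℓ' := (Classical.choose hex).2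
  have hdp' : ∀ i, m₀ ≤ i → d (i + ℓ') = d i := by
    intro i hi
    have := hw2 (i + 1) (by omega)
    have h1 := hd2 i
    have h2 := hd2 (i + ℓ')
    rw [show i + ℓ' + 1 = i + 1 + ℓ' by ring, this, h1] at h2
    exact_mod_cast h2.symm
  have key : ∀ F : ℝ → ℝ,
      (ℓ' : ℝ) * ∑ i ∈ Finset.Icc 1 ℓ, F ((h i : ℝ) - (h (i - 1) : ℝ)) =
      ℓ * ∑ i ∈ Finset.Ico (m₀ + 1) (m₀ + 1 + ℓ'), F (degZ (cfPQ α i) : ℝ) := by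
    intro F
    have := win_eq (fun i => F (d i)) i₀ ℓ m₀ ℓ' (fun i hi => by simp only [hdp i hi])
      (fun i hi => by simp only [hdp' i hi])
    rw [Finset.sum_Ico_eq_sum_range, Nat.add_sub_cancel_left]
    have e1 : ∑ i ∈ Finset.Icc 1 ℓ, F ((h i : ℝ) - (h (i - 1) : ℝ)) =
        ∑ i ∈ Finset.range ℓ, F (d (i₀ + i)) := by
      rw [← Finset.Ico_add_one_right_eq_Icc, Finset.sum_Ico_eq_sum_range]
      refine Finset.sum_congr (by simp) fun i hi => ?_
      have hi' : i < ℓ := by simpa using hi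
      congr 1
      have a1 := hh (1 + i) (by omega)
      have a2 := hh i (by omega)
      rw [show i₀ + (1 + i) = i₀ + i + 1 by ring, hDs] at a1
      have a3 : h (1 + i) = h i + d (i₀ + i) := by omega
      rw [Nat.add_sub_cancel_left, a3]
      push_cast; ring
    have e2 : ∑ i ∈ Finset.range ℓ', F (degZ (cfPQ α (m₀ + 1 + i)) : ℝ) =
        ∑ i ∈ Finset.range ℓ', F (d (m₀ + i)) := by
      refine Finset.sum_congr rfl fun i _ => ?_
      rw [show m₀ + 1 + i = m₀ + i + 1 by ring, hd2]
      simp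
    rw [e1, e2]
    exact this
  have k1 := key (fun x => max (x - n) 0)
  have k2 := key (fun x => x)
  have tel : ∑ i ∈ Finset.Icc 1 ℓ, ((h i : ℝ) - (h (i - 1) : ℝ)) = (h ℓ : ℝ) - h 0 := by
    rw [← Finset.Ico_add_one_right_eq_Icc, Finset.sum_Ico_eq_sum_range]
    simp only [Nat.add_sub_cancel, Nat.add_sub_cancel_left]
    rw [← Finset.sum_range_sub (fun i => (h i : ℝ))]
    refine Finset.sum_congr rfl fun i _ => ?_
    rw [add_comm]
  rw [tel] at k2
  have hℓ0 : (ℓ : ℝ) ≠ 0 := by positivity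
  have hℓ'0 : (ℓ' : ℝ) ≠ 0 := by
    have : 1 ≤ ℓ' := hw1
    positivity
  rw [← mul_div_mul_left _ _ hℓ0, ← k1, ← k2, mul_div_mul_left _ _ hℓ'0]

/-- For a quadratic irrational `Θ = t⁻¹ ∑ s_i t^{-i}`, every diagonal of
the number wall of `S` is eventually periodic; and, for any choice of consecutive nonzero
entries `h_{k,0} < ... < h_{k,ℓ_k}` in the periodic part of the `k`-th diagonal spanning one
full period, `Θ` exhibits `c` escape of mass w.r.t. `{t^k}` iff
`lim_n liminf_k (∑_i max(h_{k,i} − h_{k,i−1} − n, 0)) / (h_{k,ℓ_k} − h_{k,0}) ≥ c`. -/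
theorem wall_escape_equiv {K : Type} [Field K] [Fintype K] (S : ℕ → K)
    (hquad : IsQuadIrr (seriesOf S)) :
    (∀ k : ℕ, ∃ N ℓ : ℕ, 1 ≤ ℓ ∧ ∀ m : ℕ, N ≤ m →
        wallEntry (extendSeq S) (m + ℓ) (((m + ℓ : ℕ) : ℤ) + k) =
          wallEntry (extendSeq S) m ((m : ℤ) + k)) ∧
    ∀ (h : ℕ → ℕ → ℕ) (ℓ : ℕ → ℕ),
      (∀ k : ℕ, 1 ≤ ℓ k) →
      (∀ k i : ℕ, i < ℓ k → h k i < h k (i + 1)) →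
      (∀ k i : ℕ, i ≤ ℓ k → wallEntry (extendSeq S) (h k i) ((h k i : ℤ) + k) ≠ 0) →
      (∀ k i : ℕ, i < ℓ k → ∀ m : ℕ, h k i < m → m < h k (i + 1) →
        wallEntry (extendSeq S) m ((m : ℤ) + k) = 0) →
      (∀ k m : ℕ, h k 0 ≤ m →
        wallEntry (extendSeq S) (m + (h k (ℓ k) - h k 0))
            (((m + (h k (ℓ k) - h k 0) : ℕ) : ℤ) + k) =
          wallEntry (extendSeq S) m ((m : ℤ) + k)) →
      ∀ c : ℝ, 0 < c → c ≤ 1 →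
        (ExhibitsEscape (tLS K) (seriesOf S) c ↔
          ∃ L : ℝ,
            Filter.Tendsto (fun n : ℕ =>
                Filter.liminf (fun k : ℕ =>
                  (∑ i ∈ Finset.Icc 1 (ℓ k),
                      max (((h k i : ℝ) - (h k (i - 1) : ℝ)) - (n : ℝ)) 0) /
                    ((h k (ℓ k) : ℝ) - (h k 0 : ℝ))) Filter.atTop)
              Filter.atTop (nhds L) ∧ c ≤ L) := by
  constructor
  · intro k
    obtain ⟨N, ℓ, hℓ, hper⟩ := hk_periodic _ (quad_tpow _ hquad k)
    have h4 : ∀ n j, N ≤ n → hk (tLS K ^ k * seriesOf S) (n + j * ℓ) =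
        hk (tLS K ^ k * seriesOf S) n := by
      intro n j hn
      induction j with
      | zero => simp
      | succ j ih =>
        rw [show n + (j + 1) * ℓ = n + j * ℓ + ℓ by ring, hper _ (by omega), ih]
    refine ⟨N, 4 * ℓ, by omega, fun m hm => ?_⟩
    rw [wall_hk, wall_hk, show m + 4 * ℓ + 1 = m + 1 + 4 * ℓ by ring, rv_four_mul,
      h4 _ 4 (by omega)]
  · intro h ℓ hℓ hmono hnz hz hper c hc0 hc1
    have hwall : ∀ k m : ℕ, wallEntry (extendSeq S) m ((m : ℤ) + k) = 0 ↔
        hk (tLS K ^ k * seriesOf S) (m + 1) = 0 := by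
      intro k m
      rw [wall_hk, mul_eq_zero, or_iff_right (rv_ne _)]
    have hr : ∀ n k : ℕ, eMassP (tLS K) (seriesOf S) k n =
        (∑ i ∈ Finset.Icc 1 (ℓ k), max (((h k i : ℝ) - (h k (i - 1) : ℝ)) - (n : ℝ)) 0) /
          ((h k (ℓ k) : ℝ) - (h k 0 : ℝ)) := by
      intro n k
      refine ratio_eq _ (quad_tpow _ hquad k) (h k) (ℓ k) (hℓ k) (hmono k) ?_ ?_ ?_ n
      · intro i hi
        rw [Ne, ← hwall]
        exact hnz k i hi
      · intro i hi m h1 h2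
        rw [← hwall]
        exact hz k i hi m h1 h2
      · intro m hm
        rw [← hwall, ← hwall, hper k m hm]
    unfold ExhibitsEscape
    simp only [hr]

end EscapeOfMass
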